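/- Let (X,x) be a pointed geodesic metric space admitting an (ε,k)-tight geodesic combing T = {T_y : y ∈ Y} with cobounded index set Y ⊆ X. Then asdimAN(Y) ≤ k, where Y carries the metric inherited from X. -/

import Mathlib

open Metric Set

/-- A family `𝒱` of subsets is uniformly bounded by `D`: every member has diameter `≤ D`. -/
def UnifBounded {X : Type*} [MetricSpace X] (𝒱 : Set (Set X)) (D : ℝ) : Prop :=
  ∀ A ∈ 𝒱, ∀ p ∈ A, ∀ q ∈ A, dist p q ≤ D

/-- The family `𝒱` has `r`-multiplicity at most `m`: every open ball of radius `r`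
meets at most `m` members of `𝒱`. -/
def MultAtMost {X : Type*} [MetricSpace X] (𝒱 : Set (Set X)) (r : ℝ) (m : ℕ) : Prop :=
  ∀ x : X, {A | A ∈ 𝒱 ∧ (A ∩ Metric.ball x r).Nonempty}.Finite ∧
    {A | A ∈ 𝒱 ∧ (A ∩ Metric.ball x r).Nonempty}.ncard ≤ m

/-- `D` is an `n`-dimensional control function for `X`: for every `r > 0` there is a cover
of `X` uniformly bounded by `D r` whose `r`-multiplicity is at most `n + 1`. -/
def IsControlFunction (X : Type*) [MetricSpace X] (n : ℕ) (D : ℝ → ℝ) : Prop :=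
  ∀ r > 0, ∃ 𝒱 : Set (Set X), ⋃₀ 𝒱 = Set.univ ∧ UnifBounded 𝒱 (D r) ∧ MultAtMost 𝒱 r (n + 1)

/-- The asymptotic Assouad–Nagata dimension of `X` is at most `n`: some linear function
`D r = a * r + b` with `a, b > 0` is an `n`-dimensional control function for `X`. -/
def ASDimANLe (X : Type*) [MetricSpace X] (n : ℕ) : Prop :=
  ∃ a > (0 : ℝ), ∃ b > (0 : ℝ), IsControlFunction X n (fun r => a * r + b)

/-- `X` is a geodesic metric space: any two points are joined by an isometrically
parametrized geodesic segment. -/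
def IsGeodesicSpace (X : Type*) [MetricSpace X] : Prop :=
  ∀ a b : X, ∃ γ : ℝ → X, γ 0 = a ∧ γ (dist a b) = b ∧
    ∀ s ∈ Set.Icc (0 : ℝ) (dist a b), ∀ t ∈ Set.Icc (0 : ℝ) (dist a b),
      dist (γ s) (γ t) = |s - t|

/-- A geodesic combing of the pointed metric space `(X, x)`: a cobounded set `Y ⊆ X`
together with, for each `y ∈ Y`, a geodesic `γ y` from `x` to `y`. -/
structure GeodesicCombing (X : Type*) [MetricSpace X] (x : X) where
  Y : Set X
  cobounded : ∃ c > (0 : ℝ), ∀ z : X, Metric.infDist z Y ≤ c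
  γ : X → ℝ → X
  start : ∀ y ∈ Y, γ y 0 = x
  finish : ∀ y ∈ Y, γ y (dist x y) = y
  geod : ∀ y ∈ Y, ∀ s ∈ Set.Icc (0 : ℝ) (dist x y), ∀ t ∈ Set.Icc (0 : ℝ) (dist x y),
    dist (γ y s) (γ y t) = |s - t|

/-- The image `T_y` of the combing geodesic from `x` to `y`, as a subset of `X`. -/
def GeodesicCombing.seg {X : Type*} [MetricSpace X] {x : X} (C : GeodesicCombing X x)
    (y : X) : Set X :=
  C.γ y '' Set.Icc 0 (dist x y)

/-- `T(y, s)`: the union of the combing geodesics `T_{y'}` over `y' ∈ Y` with `d(y, y') < s`. -/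
def GeodesicCombing.tube {X : Type*} [MetricSpace X] {x : X} (C : GeodesicCombing X x)
    (y : X) (s : ℝ) : Set X :=
  ⋃ y' ∈ C.Y ∩ Metric.ball y s, C.seg y'

/-- The combing is `(ε, k)`-tight: for all `r > 0`, `y ∈ Y`, and `t ≤ d(x, y) - r`,
the set `T(y, ε r) ∩ S(t)` has at most `k` elements. -/
def GeodesicCombing.Tight {X : Type*} [MetricSpace X] {x : X} (C : GeodesicCombing X x)
    (ε : ℝ) (k : ℕ) : Prop :=
  ∀ r > (0 : ℝ), ∀ y ∈ C.Y, ∀ t : ℝ, t ≤ dist x y - r →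
    (C.tube y (ε * r) ∩ Metric.sphere x t).Finite ∧
    (C.tube y (ε * r) ∩ Metric.sphere x t).ncard ≤ k

/-- The `r`-chain relation on the points of `P` whose index `σ` is less than `s`. -/
def ChainStep {Z : Type*} [MetricSpace Z] (P : Set Z) (σ : Z → ℕ) (r : ℝ) (s : ℕ)
    (a b : Z) : Prop :=
  a ∈ P ∧ b ∈ P ∧ σ a < s ∧ σ b < s ∧ dist a b < r

lemma ChainStep.symm {Z : Type*} [MetricSpace Z] {P : Set Z} {σ : Z → ℕ} {r : ℝ} {s : ℕ}
    {a b : Z} (h : ChainStep P σ r s a b) : ChainStep P σ r s b a :=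
  ⟨h.2.1, h.1, h.2.2.2.1, h.2.2.1, by rw [dist_comm]; exact h.2.2.2.2⟩

/-- If the pieces (fibres of `ℓ`) of index `s` are `Δ s`-bounded and farther apart than any chain
of pieces of smaller index, then chains are bounded. -/
lemma dist_le_of_chain {Z β : Type*} [MetricSpace Z] {P : Set Z} {σ : Z → ℕ} {r : ℝ}
    (hr : 0 < r) (ℓ : Z → β) (B Δ : ℕ → ℝ) (hB : ∀ s, 0 ≤ B s) (hΔ : ∀ s, 0 ≤ Δ s)
    (hstep : ∀ s, 2 * B s + 2 * r + Δ s ≤ B (s + 1))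
    (hsep : ∀ y ∈ P, ∀ z ∈ P, σ y = σ z → dist y z < B (σ y) + 2 * r → ℓ y = ℓ z)
    (hbdd : ∀ y ∈ P, ∀ z ∈ P, σ y = σ z → ℓ y = ℓ z → dist y z ≤ Δ (σ y))
    (s : ℕ) {a b : Z} (h : Relation.ReflTransGen (ChainStep P σ r s) a b) :
    dist a b ≤ B s := by
  induction s generalizing a b with
  | zero =>
    cases h with
    | refl => simpa using hB 0
    | tail _ h => exact absurd h.2.2.1 (Nat.not_lt_zero _)
  | succ s ih =>
    by_cases hab : a = b
    · subst hab; simpa using hB (s + 1)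
    have haP : a ∈ P ∧ σ a < s + 1 := by
      rcases Relation.ReflTransGen.cases_head h with h | ⟨c, h, -⟩
      · exact absurd h hab
      · exact ⟨h.1, h.2.2.1⟩
    have key : (Relation.ReflTransGen (ChainStep P σ r s) a b ∧ σ b < s) ∨
        ∃ c ∈ P, ∃ e ∈ P, σ c = s ∧ σ e = s ∧ ℓ c = ℓ e ∧ dist a c ≤ B s + r ∧
          (e = b ∨ ∃ f, dist e f < r ∧ Relation.ReflTransGen (ChainStep P σ r s) f b ∧
            σ b < s) := by
      clear hab
      induction h with
      | refl =>
        rcases Nat.lt_succ_iff_lt_or_eq.1 haP.2 with h | h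
        · exact Or.inl ⟨.refl, h⟩
        · exact Or.inr ⟨a, haP.1, a, haP.1, h, h, rfl, by simpa using add_nonneg (hB s) hr.le,
            Or.inl rfl⟩
      | @tail b b' _ hbb ihb =>
        obtain ⟨hbP, hbP', -, hσ', hd⟩ := hbb
        rcases Nat.lt_succ_iff_lt_or_eq.1 hσ' with hlt | heq
        · rcases ihb with ⟨h1, h2⟩ | ⟨c, hc, e, he, h1, h2, h3, h4, rfl | ⟨f, h5, h6, h7⟩⟩
          · exact Or.inl ⟨h1.tail ⟨hbP, hbP', h2, hlt, hd⟩, hlt⟩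
          · exact Or.inr ⟨c, hc, e, he, h1, h2, h3, h4, Or.inr ⟨b', hd, .refl, hlt⟩⟩
          · exact Or.inr ⟨c, hc, e, he, h1, h2, h3, h4,
              Or.inr ⟨f, h5, h6.tail ⟨hbP, hbP', h7, hlt, hd⟩, hlt⟩⟩
        · refine Or.inr ?_
          rcases ihb with ⟨h1, h2⟩ | ⟨c, hc, e, he, h1, h2, h3, h4, h5⟩
          · refine ⟨b', hbP', b', hbP', heq, heq, rfl, ?_, Or.inl rfl⟩
            linarith [ih h1, dist_triangle a b b']
          · refine ⟨c, hc, b', hbP', h1, heq, h3.trans ?_, h4, Or.inl rfl⟩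
            apply hsep e he b' hbP' (h2.trans heq.symm)
            rw [h2]
            rcases h5 with rfl | ⟨f, h5, h6, -⟩
            · linarith [hB s]
            · linarith [ih h6, dist_triangle e b b', dist_triangle e f b]
    rcases key with ⟨h1, -⟩ | ⟨c, hc, e, he, h1, h2, h3, h4, h5⟩
    · linarith [ih h1, hstep s, hB s, hΔ s]
    · have hce := hbdd c hc e he (h1.trans h2.symm) h3
      rw [h1] at hce
      have heb : dist e b ≤ B s + r := by
        rcases h5 with rfl | ⟨f, h5, h6, -⟩
        · simpa using add_nonneg (hB s) hr.le
        · linarith [ih h6, dist_triangle e f b]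
      linarith [hstep s, dist_triangle a c b, dist_triangle c e b]

/-- A set covered by `D`-bounded classes with `(k + 1) * ρ`-multiplicity at most `k` splits into
`k` parts, each a `ρ`-separated union of `(k * ρ + D)`-bounded pieces. -/
lemma exists_separated_pieces {Z β : Type*} [MetricSpace Z] (A : Set Z) (π : Z → β) (k : ℕ)
    {ρ D : ℝ} (hρ : 0 < ρ)
    (hmult : ∀ y ∈ A, (π '' (A ∩ Metric.ball y ((k + 1) * ρ))).Finite ∧
      (π '' (A ∩ Metric.ball y ((k + 1) * ρ))).ncard ≤ k)
    (hdiam : ∀ y ∈ A, ∀ z ∈ A, π y = π z → dist y z ≤ D) :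
    ∃ (m : Z → ℕ) (ℓ : Z → Set β), (∀ y ∈ A, 1 ≤ m y ∧ m y ≤ k) ∧
      (∀ y ∈ A, ∀ z ∈ A, m y = m z → dist y z < ρ → ℓ y = ℓ z) ∧
      (∀ y ∈ A, ∀ z ∈ A, m y = m z → ℓ y = ℓ z → dist y z ≤ k * ρ + D) := by
  set N : Z → ℕ → Set β := fun y i => π '' (A ∩ Metric.ball y (i * ρ)) with hN
  have hmono : ∀ y i j, i ≤ j → N y i ⊆ N y j := by
    intro y i j hij
    apply image_mono
    apply inter_subset_inter_right
    apply Metric.ball_subset_ball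
    gcongr
  have htop : ∀ y ∈ A, (N y (k + 1)).Finite ∧ (N y (k + 1)).ncard ≤ k := by
    intro y hy
    simpa [hN] using hmult y hy
  have hfin : ∀ y ∈ A, ∀ i ≤ k + 1, (N y i).Finite := fun y hy i hi =>
    (htop y hy).1.subset (hmono y _ _ hi)
  have hself : ∀ y ∈ A, ∀ i, 1 ≤ i → π y ∈ N y i := by
    intro y hy i hi
    have : (0 : ℝ) < i := by exact_mod_cast hi
    exact ⟨y, ⟨hy, Metric.mem_ball_self (by positivity)⟩, rfl⟩
  have hex : ∀ y, ∃ m : ℕ, y ∈ A → 1 ≤ m ∧ m ≤ k ∧ (N y m).ncard = m ∧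
      N y (m + 1) = N y m := by
    intro y
    by_cases hy : y ∈ A
    swap
    · exact ⟨0, fun h => absurd h hy⟩
    have h1 : 1 ≤ (N y 1).ncard :=
      (Set.ncard_pos (hfin y hy 1 (by omega))).2 ⟨_, hself y hy 1 le_rfl⟩
    have hP : ∃ n, (N y (n + 1)).ncard < n + 1 := ⟨k, by have := (htop y hy).2; omega⟩
    classical
    have hn := Nat.find_spec hP
    have hmin : ∀ n < Nat.find hP, ¬ (N y (n + 1)).ncard < n + 1 := fun n => Nat.find_min hP
    have hle : Nat.find hP ≤ k := Nat.find_min' hP (by have := (htop y hy).2; omega)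
    generalize Nat.find hP = n at *
    obtain _ | n := n
    · simp at hn
      simp [hn] at h1
    refine ⟨n + 1, fun _ => ?_⟩
    have h2 := hmin n (by omega)
    have hsub := hmono y (n + 1) (n + 1 + 1) (by omega)
    have h3 := Set.ncard_le_ncard hsub (hfin y hy _ (by omega))
    exact ⟨by omega, hle, by omega,
      (Set.eq_of_subset_of_ncard_le hsub (by omega) (hfin y hy _ (by omega))).symm⟩
  choose m hm using hex
  refine ⟨m, fun y => N y (m y), fun y hy => ⟨(hm y hy).1, (hm y hy).2.1⟩, ?_, ?_⟩
  · intro y hy z hz hyz hd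
    obtain ⟨-, hk, hc, he⟩ := hm y hy
    obtain ⟨-, -, hc', -⟩ := hm z hz
    have hsub : N z (m z) ⊆ N y (m y) := by
      rw [← he, ← hyz]
      apply image_mono
      apply inter_subset_inter_right
      apply Metric.ball_subset_ball'
      rw [dist_comm]
      push_cast
      linarith
    exact (Set.eq_of_subset_of_ncard_le hsub (by omega) (hfin y hy _ (by omega))).symm
  · intro y hy z hz hyz hl
    obtain ⟨h1, hk, -, -⟩ := hm y hy
    have hmem : π z ∈ N y (m y) := by
      have hl' : N y (m y) = N z (m z) := hl
      rw [hl']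
      exact hself z hz _ (hm z hz).1
    obtain ⟨w, ⟨hw, hwy⟩, hwz⟩ := hmem
    have h2 := hdiam w hw z hz hwz
    rw [Metric.mem_ball, dist_comm] at hwy
    have h3 : (m y : ℝ) * ρ ≤ k * ρ := by gcongr
    linarith [dist_triangle y w z]

lemma GeodesicCombing.dist_γ {X : Type*} [MetricSpace X] {x : X} (C : GeodesicCombing X x)
    {y : X} (hy : y ∈ C.Y) {t : ℝ} (h0 : 0 ≤ t) (ht : t ≤ dist x y) :
    dist x (C.γ y t) = t ∧ dist y (C.γ y t) = dist x y - t := by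
  have h1 := C.geod y hy 0 ⟨le_rfl, dist_nonneg⟩ t ⟨h0, ht⟩
  have h2 := C.geod y hy (dist x y) ⟨dist_nonneg, le_rfl⟩ t ⟨h0, ht⟩
  rw [C.start y hy, zero_sub, abs_neg, abs_of_nonneg h0] at h1
  rw [C.finish y hy, abs_of_nonneg (by linarith)] at h2
  exact ⟨h1, h2⟩

/-- The annulus of index set points `y` with `⌊d(x, y) / M⌋ = j` splits into `k` parts, each a
`ρ`-separated union of pieces with diameter linear in `ρ` and `M`. -/
lemma GeodesicCombing.Tight.exists_annulus_pieces {X : Type*} [MetricSpace X] {x : X}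
    {C : GeodesicCombing X x} {ε : ℝ} {k : ℕ} (ht : C.Tight ε k) (hε : 0 < ε) (hk : 1 ≤ k)
    {M ρ : ℝ} (hM : 0 < M) (hρ : 0 < ρ) (j : ℕ) :
    ∃ (m : C.Y → ℕ) (ℓ : C.Y → Set X),
      (∀ y : C.Y, ⌊dist x y / M⌋₊ = j → 1 ≤ m y ∧ m y ≤ k) ∧
      (∀ y z : C.Y, ⌊dist x y / M⌋₊ = j → ⌊dist x z / M⌋₊ = j → m y = m z →
        dist y z < ρ → ℓ y = ℓ z) ∧
      (∀ y z : C.Y, ⌊dist x y / M⌋₊ = j → ⌊dist x z / M⌋₊ = j → m y = m z →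
        ℓ y = ℓ z → dist y z ≤ k * ρ + 2 * (M + (k + 1) * ρ / ε)) := by
  set h : ℝ := (k + 1) * ρ / ε with hh
  have hpos : 0 < h := by positivity
  have hεh : ε * h = (k + 1) * ρ := by rw [hh]; field_simp
  set t : ℝ := max 0 (j * M - h) with htdef
  have ht0 : 0 ≤ t := le_max_left _ _
  have htj : t ≤ j * M := max_le (by positivity) (by linarith)
  have htj' : j * M - h ≤ t := le_max_right _ _
  have hA : ∀ y : C.Y, ⌊dist x y / M⌋₊ = j → j * M ≤ dist x y ∧ dist x y < j * M + M := by
    intro y hy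
    rw [Nat.floor_eq_iff (by positivity), le_div_iff₀ hM, div_lt_iff₀ hM] at hy
    exact ⟨hy.1, by linarith [hy.2]⟩
  have hpieces := exists_separated_pieces {y : C.Y | ⌊dist x y / M⌋₊ = j}
    (fun y => C.γ y t) k (D := 2 * (M + h)) hρ ?_ ?_
  · obtain ⟨m, ℓ, h1, h2, h3⟩ := hpieces
    exact ⟨m, ℓ, h1, fun y z hy hz => h2 y hy z hz, fun y z hy hz => h3 y hy z hz⟩
  · intro y hy
    by_cases hc : j * M - h ≤ 0
    · have hsub : ((fun y : C.Y => C.γ y t) '' ({y : C.Y | ⌊dist x y / M⌋₊ = j} ∩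
          Metric.ball y ((k + 1) * ρ))) ⊆ {x} := by
        rintro _ ⟨z, -, rfl⟩
        simp [htdef, max_eq_left hc, C.start z z.2]
      refine ⟨(Set.finite_singleton x).subset hsub, ?_⟩
      have := Set.ncard_le_ncard hsub (Set.finite_singleton x)
      rw [Set.ncard_singleton] at this
      omega
    · have hteq : t = j * M - h := max_eq_right (by linarith)
      obtain ⟨hf, hn⟩ := ht h hpos y y.2 t (by linarith [(hA y hy).1])
      have hsub : ((fun y : C.Y => C.γ y t) '' ({y : C.Y | ⌊dist x y / M⌋₊ = j} ∩
          Metric.ball y ((k + 1) * ρ))) ⊆ C.tube y (ε * h) ∩ Metric.sphere x t := by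
        rintro _ ⟨z, ⟨hz, hzy⟩, rfl⟩
        have htz := htj.trans (hA z hz).1
        refine ⟨Set.mem_biUnion (x := (z : X)) ⟨z.2, ?_⟩ ⟨t, ⟨ht0, htz⟩, rfl⟩, ?_⟩
        · rw [hεh]; exact hzy
        · rw [Metric.mem_sphere, dist_comm]
          exact (C.dist_γ z.2 ht0 htz).1
      exact ⟨hf.subset hsub, (Set.ncard_le_ncard hsub hf).trans hn⟩
  · intro y hy z hz hyz
    have hy1 := hA y hy
    have hz1 := hA z hz
    have hy2 := (C.dist_γ y.2 ht0 (htj.trans hy1.1)).2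
    have hz2 := (C.dist_γ z.2 ht0 (htj.trans hz1.1)).2
    have hyz' : C.γ y t = C.γ z t := hyz
    rw [← hyz', dist_comm] at hz2
    have := dist_triangle (y : X) (C.γ y t) z
    rw [Subtype.dist_eq]
    linarith

/-- Coefficients of the bounds on chains in terms of the step size. -/
noncomputable def chainBound (ε : ℝ) (k : ℕ) : ℕ → ℝ
  | 0 => 0
  | s + 1 => 2 * chainBound ε k s + 2 +
      (k * (chainBound ε k s + 2) + 2 * (1 + (k + 1) * (chainBound ε k s + 2) / ε))

lemma chainBound_nonneg {ε : ℝ} (hε : 0 < ε) (k s : ℕ) : 0 ≤ chainBound ε k s := by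
  induction s with
  | zero => exact le_rfl
  | succ s ih => rw [chainBound]; positivity

lemma floor_div_le_floor_div_add_one {M a b : ℝ} (hM : 0 < M) (hb : 0 ≤ b)
    (h : |a - b| < M) : ⌊a / M⌋₊ ≤ ⌊b / M⌋₊ + 1 := by
  have h1 : a / M ≤ b / M + 1 := by
    rw [div_add_one hM.ne']
    gcongr
    linarith [le_abs_self (a - b)]
  calc ⌊a / M⌋₊ ≤ ⌊b / M + 1⌋₊ := Nat.floor_le_floor h1
    _ = _ := Nat.floor_add_one (by positivity)

lemma eq_of_mod_eq_of_lt {a b n : ℕ} (h : a % n = b % n) (h1 : a < b + n) (h2 : b < a + n) :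
    a = b := by
  apply Nat.ModEq.eq_of_abs_lt h
  rw [abs_lt]
  omega

lemma GeodesicCombing.Tight.isControlFunction {X : Type*} [MetricSpace X] {x : X}
    {C : GeodesicCombing X x} {ε : ℝ} {k : ℕ} (ht : C.Tight ε k) (hε : 0 < ε) (hk : 1 ≤ k) :
    IsControlFunction C.Y k (fun r => chainBound ε k (k + 1) * (2 * r)) := by
  intro r hr
  set M : ℝ := 2 * r with hMdef
  have hM : 0 < M := by positivity
  set B : ℕ → ℝ := fun s => chainBound ε k s * M with hB
  have hβ := chainBound_nonneg hε k
  have hB0 : ∀ s, 0 ≤ B s := fun s => mul_nonneg (hβ s) hM.le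
  have hρ : ∀ s, 0 < B s + 2 * M := fun s => by linarith [hB0 s]
  set J : C.Y → ℕ := fun y => ⌊dist x y / M⌋₊ with hJ
  have hpieces := fun j : ℕ =>
    ht.exists_annulus_pieces hε hk hM (hρ (j % (k + 1))) j
  choose m ℓ hm hsep hbdd using hpieces
  set w : C.Y → ℕ := fun y => J y + m (J y) y with hw
  have hmy : ∀ y, 1 ≤ m (J y) y ∧ m (J y) y ≤ k := fun y => hm (J y) y rfl
  have hJle : ∀ y z : C.Y, dist y z < M → J y ≤ J z + 1 := by
    intro y z h
    apply floor_div_le_floor_div_add_one hM dist_nonneg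
    refine lt_of_le_of_lt ?_ h
    rw [dist_comm x y, dist_comm x z]
    exact abs_dist_sub_le _ _ _
  set σ : C.Y → ℕ := fun y => J y % (k + 1) with hσ
  let R : ℕ → C.Y → C.Y → Prop := fun i => ChainStep {y | w y = i} σ M (k + 1)
  let comp : C.Y → Set C.Y := fun y => {z | Relation.ReflTransGen (R (w y)) y z}
  have hσlt : ∀ y, σ y < k + 1 := fun y => Nat.mod_lt _ (by omega)
  have hRsymm : ∀ i a b, Relation.ReflTransGen (R i) a b → Relation.ReflTransGen (R i) b a :=
    fun i a b h =>
      have : Std.Symm (R i) := ⟨fun _ _ h => h.symm⟩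
      Relation.ReflTransGen.stdSymm.symm _ _ h
  have hw_of : ∀ i a b, w a = i → Relation.ReflTransGen (R i) a b → w b = i := by
    intro i a b ha h
    cases h with
    | refl => exact ha
    | tail _ h => exact h.2.1
  have hJeq : ∀ y z, w y = w z → σ y = σ z → J y = J z := by
    intro y z h1 h2
    have h3 := hmy y
    have h4 := hmy z
    simp only [hw] at h1
    exact eq_of_mod_eq_of_lt h2 (by omega) (by omega)
  have hdist : ∀ i a b, Relation.ReflTransGen (R i) a b → dist a b ≤ B (k + 1) := by
    intro i a b h
    refine dist_le_of_chain hM (fun y => ℓ (J y) y) B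
      (fun s => k * (B s + 2 * M) + 2 * (M + (k + 1) * (B s + 2 * M) / ε)) hB0 ?_ ?_ ?_ ?_
      (k + 1) h
    · intro s
      have := hρ s
      positivity
    · intro s
      simp only [hB, chainBound]
      apply le_of_eq
      ring
    · intro y hy z hz hs hd
      have hj := hJeq y z (Eq.trans hy (Eq.symm hz)) hs
      have hww : w y = w z := Eq.trans hy (Eq.symm hz)
      simp only [hw, ← hj] at hww
      show ℓ (J y) y = ℓ (J z) z
      rw [← hj]
      exact hsep (J y) y z rfl hj.symm (by omega) hd
    · intro y hy z hz hs hl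
      have hj := hJeq y z (Eq.trans hy (Eq.symm hz)) hs
      have hww : w y = w z := Eq.trans hy (Eq.symm hz)
      simp only [hw, ← hj] at hww hl
      exact hbdd (J y) y z rfl hj.symm (by omega) hl
  have hcomp : ∀ y z u v, u ∈ comp y → v ∈ comp z → dist u v < M →
      w y % (k + 1) = w z % (k + 1) → comp y = comp z := by
    intro y z u v hu hv hd hyz
    have hwu := hw_of _ _ _ rfl hu
    have hwv := hw_of _ _ _ rfl hv
    have h1 := hJle u v hd
    have h2 := hJle v u (by rwa [dist_comm])
    have h3 := hmy u
    have h4 := hmy v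
    have hwyz : w y = w z := by
      rw [← hwu, ← hwv] at hyz ⊢
      simp only [hw] at hyz ⊢
      exact eq_of_mod_eq_of_lt hyz (by omega) (by omega)
    have hRuv : R (w y) u v := ⟨hwu, hwv.trans hwyz.symm, hσlt u, hσlt v, hd⟩
    have hv' : Relation.ReflTransGen (R (w y)) z v := by rw [hwyz]; exact hv
    have hconn : Relation.ReflTransGen (R (w y)) y z :=
      (Relation.ReflTransGen.tail hu hRuv).trans (hRsymm _ _ _ hv')
    ext p
    show Relation.ReflTransGen (R (w y)) y p ↔ Relation.ReflTransGen (R (w z)) z p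
    rw [← hwyz]
    exact ⟨fun h => (hRsymm _ _ _ hconn).trans h, fun h => hconn.trans h⟩
  refine ⟨Set.range comp, ?_, ?_, ?_⟩
  · exact Set.eq_univ_of_forall fun y => ⟨comp y, ⟨y, rfl⟩, Relation.ReflTransGen.refl⟩
  · rintro _ ⟨y, rfl⟩ p hp q hq
    exact hdist (w y) p q ((hRsymm _ _ _ hp).trans hq)
  · intro c
    have hrep : ∀ A : Set C.Y, ∃ i : ℕ, A ∈ Set.range comp → ∃ y, comp y = A ∧
        w y % (k + 1) = i := by
      intro A
      by_cases hA : A ∈ Set.range comp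
      · obtain ⟨y, rfl⟩ := hA
        exact ⟨_, fun _ => ⟨y, rfl, rfl⟩⟩
      · exact ⟨0, fun h => absurd h hA⟩
    choose col hcol using hrep
    set S : Set (Set C.Y) := {A | A ∈ Set.range comp ∧ (A ∩ Metric.ball c r).Nonempty} with hS
    have hmaps : Set.MapsTo col S (Finset.range (k + 1) : Set ℕ) := by
      rintro A ⟨hA, -⟩
      obtain ⟨y, -, hy⟩ := hcol A hA
      rw [← hy]
      simpa using Nat.lt_succ_iff.1 (Nat.mod_lt (w y) (Nat.succ_pos k))
    have hinj : Set.InjOn col S := by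
      rintro A ⟨hA, u, huA, hu⟩ A' ⟨hA', v, hvA, hv⟩ h
      obtain ⟨y, rfl, hy⟩ := hcol A hA
      obtain ⟨z, rfl, hz⟩ := hcol A' hA'
      refine hcomp y z u v huA hvA ?_ (hy.trans (h.trans hz.symm))
      rw [Metric.mem_ball] at hu hv
      linarith [dist_triangle_right u v c]
    refine ⟨Set.Finite.of_injOn hmaps hinj (Finset.finite_toSet _), ?_⟩
    have := Set.ncard_le_ncard_of_injOn col hmaps hinj (Finset.finite_toSet _)
    rwa [Set.ncard_coe_finset, Finset.card_range] at this

/-- A `(ε, 0)`-tight combing has no index point away from the base point. -/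
lemma GeodesicCombing.Tight.subsingleton_of_zero {X : Type*} [MetricSpace X] {x : X}
    {C : GeodesicCombing X x} {ε : ℝ} (ht : C.Tight ε 0) (hε : 0 < ε) : Subsingleton C.Y := by
  have h : ∀ y ∈ C.Y, x = y := by
    intro y hy
    by_contra hne
    have hpos : 0 < dist x y := dist_pos.2 hne
    obtain ⟨hf, hn⟩ := ht (dist x y) hpos y hy 0 (by simp)
    have hmem : x ∈ C.tube y (ε * dist x y) ∩ Metric.sphere x 0 := by
      refine ⟨Set.mem_biUnion (x := y) ⟨hy, Metric.mem_ball_self (by positivity)⟩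
        ⟨0, ⟨le_rfl, hpos.le⟩, C.start y hy⟩, by simp⟩
    rw [(Set.ncard_eq_zero hf).1 (Nat.le_zero.1 hn)] at hmem
    exact hmem
  exact ⟨fun y z => Subtype.ext ((h y y.2).symm.trans (h z z.2))⟩

lemma IsControlFunction.mono {X : Type*} [MetricSpace X] {n : ℕ} {D D' : ℝ → ℝ}
    (h : IsControlFunction X n D) (hD : ∀ r > 0, D r ≤ D' r) : IsControlFunction X n D' := by
  intro r hr
  obtain ⟨𝒱, h1, h2, h3⟩ := h r hr
  exact ⟨𝒱, h1, fun A hA p hp q hq => (h2 A hA p hp q hq).trans (hD r hr), h3⟩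

lemma isControlFunction_zero_of_subsingleton {X : Type*} [MetricSpace X] [Subsingleton X]
    (n : ℕ) : IsControlFunction X n (fun _ => 0) := by
  intro r _
  refine ⟨{Set.univ}, by simp, fun A _ p _ q _ => by simp [Subsingleton.elim p q], fun c => ?_⟩
  have hsub : {A : Set X | A ∈ ({Set.univ} : Set (Set X)) ∧ (A ∩ Metric.ball c r).Nonempty} ⊆
      {Set.univ} := fun A hA => hA.1
  refine ⟨(Set.finite_singleton _).subset hsub, ?_⟩
  have := Set.ncard_le_ncard hsub (Set.finite_singleton _)
  rw [Set.ncard_singleton] at this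
  omega

/-- Let `(X, x)` be a pointed geodesic metric space admitting an `(ε, k)`-tight geodesic
combing with cobounded index set `Y ⊆ X`.  Then `asdimAN Y ≤ k`, where `Y` carries the
metric inherited from `X`. -/
theorem asdimAN_combing_index_set_le {X : Type*} [MetricSpace X] (x : X)
    (hX : IsGeodesicSpace X) (ε : ℝ) (hε : 0 < ε) (k : ℕ)
    (C : GeodesicCombing X x) (ht : C.Tight ε k) :
    ASDimANLe ↥C.Y k := by
  rcases Nat.eq_zero_or_pos k with rfl | hk
  · have := ht.subsingleton_of_zero hε
    exact ⟨1, one_pos, 1, one_pos,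
      (isControlFunction_zero_of_subsingleton 0).mono fun r hr => by positivity⟩
  · have hβ := chainBound_nonneg hε k (k + 1)
    exact ⟨2 * chainBound ε k (k + 1) + 1, by positivity, 1, one_pos,
      (ht.isControlFunction hε hk).mono fun r hr => by linarith⟩
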